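/- arXiv:1610.00117 — 2 statements merged into one kernel-verified Lean document; each statement's English description precedes it below -/
import Mathlib

section
/- For all n × n matrices A with nonnegative real entries such that every row sum of A equals 1 (doubly stochastic matrices also have column sums 1), if A is doubly stochastic then per(A) ≥ n!/n^n. -/
/-- The permanent of an `n × n` matrix. -/
def permanent {n : ℕ} (A : Matrix (Fin n) (Fin n) ℝ) : ℝ :=
  ∑ σ : Equiv.Perm (Fin n), ∏ i : Fin n, A i (σ i)

open Polynomial in
/-- The restriction of `g` to the line `y + t a`. -/
noncomputable def vdwLine {n : ℕ} {K : Type} [Field K] [Algebra ℝ K] (y a : Fin n → K)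
    (g : MvPolynomial (Fin n) ℝ) : K[X] :=
  MvPolynomial.aeval (fun i => C (y i) + C (a i) * X) g

/-- Directional derivative. -/
noncomputable def vdwD {n : ℕ} (a : Fin n → ℝ) (g : MvPolynomial (Fin n) ℝ) :
    MvPolynomial (Fin n) ℝ :=
  ∑ i, MvPolynomial.C (a i) * MvPolynomial.pderiv i g

theorem vdwD_C {n : ℕ} (a : Fin n → ℝ) (r : ℝ) : vdwD a (MvPolynomial.C r) = 0 := by
  simp [vdwD]

theorem vdwD_X {n : ℕ} (a : Fin n → ℝ) (j : Fin n) :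
    vdwD a (MvPolynomial.X j) = MvPolynomial.C (a j) := by
  classical
  simp [vdwD, MvPolynomial.pderiv_X, Pi.single_apply]

theorem vdwD_add {n : ℕ} (a : Fin n → ℝ) (p q : MvPolynomial (Fin n) ℝ) :
    vdwD a (p + q) = vdwD a p + vdwD a q := by
  simp [vdwD, mul_add, Finset.sum_add_distrib]

theorem vdwD_mul {n : ℕ} (a : Fin n → ℝ) (p q : MvPolynomial (Fin n) ℝ) :
    vdwD a (p * q) = p * vdwD a q + q * vdwD a p := by
  simp only [vdwD, Derivation.leibniz, Finset.mul_sum, ← Finset.sum_add_distrib, smul_eq_mul]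
  refine Finset.sum_congr rfl fun i _ => ?_
  ring

theorem vdwD_C_mul {n : ℕ} (a : Fin n → ℝ) (r : ℝ) (p : MvPolynomial (Fin n) ℝ) :
    vdwD a (MvPolynomial.C r * p) = MvPolynomial.C r * vdwD a p := by
  rw [vdwD_mul, vdwD_C]; ring

theorem vdwD_homog {n d : ℕ} (a : Fin n → ℝ) (p : MvPolynomial (Fin n) ℝ)
    (hp : p.IsHomogeneous (d + 1)) : (vdwD a p).IsHomogeneous d := by
  refine MvPolynomial.IsHomogeneous.sum _ _ _ fun i _ => ?_
  exact (hp.pderiv (i := i)).C_mul _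

theorem vdw_scale {n d : ℕ} {K : Type} [Field K] [Algebra ℝ K] (c : K) (y : Fin n → K)
    (p : MvPolynomial (Fin n) ℝ) (hp : p.IsHomogeneous d) :
    MvPolynomial.aeval (fun i => c * y i) p = c ^ d * MvPolynomial.aeval y p := by
  simp only [MvPolynomial.aeval_def, MvPolynomial.eval₂_eq', Finset.mul_sum]
  refine Finset.sum_congr rfl fun m hm => ?_
  have h := hp.degree_eq_sum_deg_support hm
  simp only [mul_pow, Finset.prod_mul_distrib, Finset.prod_pow_eq_pow_sum]
  have : ∑ i, m i = d := by
    rw [h]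
    exact (Finset.sum_subset (Finset.subset_univ _) (by simp)).symm
  rw [this]; ring

section
open Polynomial
theorem vdwLine_eval {n : ℕ} {K : Type} [Field K] [Algebra ℝ K] (y a : Fin n → K)
    (g : MvPolynomial (Fin n) ℝ) (t : K) :
    (vdwLine y a g).eval t = MvPolynomial.aeval (fun i => y i + a i * t) g := by
  unfold vdwLine
  induction g using MvPolynomial.induction_on with
  | C r => simp [Polynomial.algebraMap_apply]
  | add p q hp hq => simp [hp, hq]
  | mul_X p i hp => simp [hp]

theorem vdwLine_map {n : ℕ} (y a : Fin n → ℝ)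
    (g : MvPolynomial (Fin n) ℝ) :
    (vdwLine y a g).map (algebraMap ℝ ℂ) = vdwLine (fun i => (y i : ℂ)) (fun i => (a i : ℂ)) g := by
  unfold vdwLine
  induction g using MvPolynomial.induction_on with
  | C r => simp [Polynomial.algebraMap_apply]
  | add p q hp hq => simp [hp, hq]
  | mul_X p i hp => simp [hp]

theorem vdwLine_derivative {n : ℕ} {K : Type} [Field K] [Algebra ℝ K] (y : Fin n → K)
    (a : Fin n → ℝ) (g : MvPolynomial (Fin n) ℝ) :
    derivative (vdwLine y (fun i => algebraMap ℝ K (a i)) g) =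
      vdwLine y (fun i => algebraMap ℝ K (a i)) (vdwD a g) := by
  unfold vdwLine
  induction g using MvPolynomial.induction_on with
  | C r => simp [Polynomial.algebraMap_apply, vdwD_C]
  | add p q hp hq => simp [hp, hq, vdwD_add]
  | mul_X p i hp =>
    simp [hp, vdwD_mul, vdwD_X, Polynomial.algebraMap_apply]
    ring

theorem vdwLine_natDegree {n d : ℕ} {K : Type} [Field K] [Algebra ℝ K] (y a : Fin n → K)
    (g : MvPolynomial (Fin n) ℝ) (hg : g.IsHomogeneous d) : (vdwLine y a g).natDegree ≤ d := by
  unfold vdwLine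
  rw [MvPolynomial.aeval_def, MvPolynomial.eval₂_eq']
  refine natDegree_sum_le_of_forall_le _ _ fun m hm => ?_
  have h := hg.degree_eq_sum_deg_support hm
  have h2 : ∑ i, m i = d := by
    rw [h]
    exact (Finset.sum_subset (Finset.subset_univ _) (by simp)).symm
  rw [Polynomial.algebraMap_apply]
  refine (natDegree_C_mul_le _ _).trans ((natDegree_prod_le _ _).trans ?_)
  rw [← h2]
  refine Finset.sum_le_sum fun i _ => natDegree_pow_le.trans ?_
  have : (C (y i) + C (a i) * X).natDegree ≤ 1 := by
    rw [add_comm]; exact natDegree_linear_le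
  nlinarith [Nat.zero_le (m i)]

/-- Nonvanishing on the product of upper half planes. -/
structure VdwGood {n : ℕ} (d : ℕ) (g : MvPolynomial (Fin n) ℝ) : Prop where
  homog : g.IsHomogeneous d
  stable : ∀ y : Fin n → ℂ, (∀ i, 0 < (y i).im) → MvPolynomial.aeval y g ≠ 0
  pos : ∀ v : Fin n → ℝ, (∀ i, 0 < v i) → 0 < MvPolynomial.aeval v g

theorem vdw_ofReal {n : ℕ} (v : Fin n → ℝ) (g : MvPolynomial (Fin n) ℝ) :
    MvPolynomial.aeval (fun i => (v i : ℂ)) g = ((MvPolynomial.aeval v g : ℝ) : ℂ) := by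
  induction g using MvPolynomial.induction_on with
  | C r => simp
  | add p q hp hq => simp [hp, hq]
  | mul_X p i hp => simp [hp]

theorem vdw_conj {n : ℕ} (v : Fin n → ℂ) (g : MvPolynomial (Fin n) ℝ) :
    MvPolynomial.aeval (fun i => (starRingEnd ℂ) (v i)) g =
      (starRingEnd ℂ) (MvPolynomial.aeval v g) := by
  induction g using MvPolynomial.induction_on with
  | C r => simp
  | add p q hp hq => simp [hp, hq]
  | mul_X p i hp => simp [hp]

theorem VdwGood.line {n d : ℕ} {g : MvPolynomial (Fin n) ℝ} (hg : VdwGood d g)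
    (y a : Fin n → ℝ) (hy : ∀ i, 0 ≤ y i) (ha : ∀ i, 0 < a i) :
    (vdwLine y a g).Splits ∧ ∀ z ∈ (vdwLine y a g).roots, z ≤ 0 := by
  constructor
  · refine Splits.of_splits_map_of_injective (i := algebraMap ℝ ℂ) (algebraMap ℝ ℂ).injective
      (IsAlgClosed.splits _) fun z hz => ?_
    have hz0 := isRoot_of_mem_roots hz
    rw [vdwLine_map, IsRoot, vdwLine_eval] at hz0
    have him : z.im = 0 := by
      rcases lt_trichotomy z.im 0 with h | h | h
      · exfalso
        refine hg.stable (fun i => y i + a i * (starRingEnd ℂ) z) (fun i => ?_) ?_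
        · have := mul_pos (ha i) (neg_pos.2 h)
          simpa using this
        · have := vdw_conj (fun i => y i + a i * z) g
          rw [hz0] at this
          simpa using this
      · exact h
      · exfalso
        refine hg.stable (fun i => y i + a i * z) (fun i => ?_) hz0
        simpa using mul_pos (ha i) h
    exact ⟨z.re, by apply Complex.ext <;> simp [him]⟩
  · intro z hz
    have hz0 := isRoot_of_mem_roots hz
    rw [IsRoot, vdwLine_eval] at hz0
    by_contra! h
    refine (hg.pos (fun i => y i + a i * z) fun i => ?_).ne' hz0
    have := mul_pos (ha i) h
    have := hy i
    positivity

theorem vdw_sum_im_neg (s : Multiset ℂ) (hs : s ≠ 0) (h : ∀ z ∈ s, z.im < 0) :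
    s.sum.im < 0 := by
  induction s using Multiset.induction_on with
  | empty => exact absurd rfl hs
  | cons a s ih =>
    have ha := h a (by simp)
    by_cases h0 : s = 0
    · simpa [h0] using ha
    · have := ih h0 (fun z hz => h z (by simp [hz]))
      simp; linarith

theorem VdwGood.deriv {n d : ℕ} {g : MvPolynomial (Fin n) ℝ} (hg : VdwGood (d + 1) g)
    (a : Fin n → ℝ) (ha : ∀ i, 0 < a i) : VdwGood d (vdwD a g) := by
  have hst : ∀ y : Fin n → ℂ, (∀ i, 0 < (y i).im) → MvPolynomial.aeval y (vdwD a g) ≠ 0 := by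
    intro y hy
    set R := vdwLine y (fun i => algebraMap ℝ ℂ (a i)) g with hR
    have h0 : R.eval 0 ≠ 0 := by
      rw [hR, vdwLine_eval]; simpa using hg.stable y hy
    have hd : R.derivative.eval 0 = MvPolynomial.aeval y (vdwD a g) := by
      rw [hR, vdwLine_derivative, vdwLine_eval]; simp
    rw [← hd]
    have hsp : R.Splits := IsAlgClosed.splits _
    have hroots : ∀ z ∈ R.roots, z.im < 0 := by
      intro z hz
      have hz0 := isRoot_of_mem_roots hz
      rw [hR, IsRoot, vdwLine_eval] at hz0
      by_contra! h
      refine hg.stable _ (fun i => ?_) hz0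
      have := mul_nonneg (ha i).le h
      have := hy i
      simp; linarith
    have hdeg : R.natDegree ≠ 0 := by
      intro h
      obtain ⟨c, hc⟩ := natDegree_eq_zero.1 h
      set S := vdwLine (fun i => algebraMap ℝ ℂ (a i)) y g with hS
      have key : X * S = X * (C c * X ^ (d + 1)) := by
        refine Polynomial.funext fun s => ?_
        by_cases hs : s = 0
        · simp [hs]
        · have h1 : S.eval s = s ^ (d + 1) * R.eval s⁻¹ := by
            rw [hS, hR, vdwLine_eval, vdwLine_eval, ← vdw_scale _ _ _ hg.homog]
            congr 2
            funext i
            field_simp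
            ring
          simp only [eval_mul, eval_X, h1, ← hc, eval_C, eval_pow]
          ring
      have key2 := mul_left_cancel₀ X_ne_zero key
      have h3 : S.eval 0 = 0 := by rw [key2]; simp
      rw [hS, vdwLine_eval] at h3
      have h4 := vdw_ofReal a g
      simp at h3
      rw [h3] at h4
      exact (hg.pos a ha).ne (by exact_mod_cast h4)
    intro hcon
    have h5 := hsp.eval_derivative_div_eval_of_ne_zero h0
    rw [hcon, zero_div] at h5
    have h6 := vdw_sum_im_neg (R.roots.map fun z => 1 / (0 - z))
      (by simpa using hsp.roots_ne_zero hdeg) (by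
        intro w hw
        obtain ⟨z, hz, rfl⟩ := Multiset.mem_map.1 hw
        have := hroots z hz
        have hz : z ≠ 0 := by rintro rfl; simp at this
        have : 0 < Complex.normSq z := Complex.normSq_pos.2 hz
        simp [Complex.inv_im, neg_div]
        exact div_neg_of_neg_of_pos ‹_› this)
    rw [← h5] at h6
    simp at h6
  have hhom := vdwD_homog a g hg.homog
  refine ⟨hhom, hst, fun v hv => ?_⟩
  have hne : MvPolynomial.aeval v (vdwD a g) ≠ 0 := by
    intro h
    refine hst (fun i => Complex.I * (v i : ℂ)) (fun i => by simpa using hv i) ?_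
    rw [vdw_scale _ _ _ hhom, vdw_ofReal, h]; simp
  refine lt_of_le_of_ne ?_ hne.symm
  obtain ⟨hsp, hr⟩ := hg.line v a (fun i => (hv i).le) ha
  have h0 : 0 < (vdwLine v a g).eval 0 := by
    rw [vdwLine_eval]; simpa using hg.pos v hv
  have hd : (vdwLine v a g).derivative.eval 0 = MvPolynomial.aeval v (vdwD a g) := by
    have := vdwLine_derivative v a g
    simp only [Algebra.algebraMap_self, RingHom.id_apply] at this
    rw [this, vdwLine_eval]; simp
  rw [← hd, hsp.eval_derivative_eq_eval_mul_sum h0.ne']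
  refine mul_nonneg h0.le (Multiset.sum_nonneg fun w hw => ?_)
  obtain ⟨z, hz, rfl⟩ := Multiset.mem_map.1 hw
  have := hr z hz
  apply div_nonneg zero_le_one; linarith
end

theorem vdw_prod_le (u : ℝ) (hu : 0 ≤ u) (s : Multiset ℝ) (hs : ∀ w ∈ s, 0 ≤ w) :
    (s.map fun w => 1 + w).prod ≤
      (1 + u) ^ s.card * Real.exp ((s.sum - s.card * u) / (1 + u)) := by
  induction s using Multiset.induction_on with
  | empty => simp
  | cons a s ih =>
    have ha := hs a (by simp)
    have ih' := ih fun w hw => hs w (by simp [hw])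
    have h1 : 1 + a ≤ (1 + u) * Real.exp ((a - u) / (1 + u)) := by
      have h := Real.add_one_le_exp ((a - u) / (1 + u))
      have : 1 + a = (1 + u) * ((a - u) / (1 + u) + 1) := by field_simp; ring
      rw [this]; gcongr
    rw [Multiset.map_cons, Multiset.prod_cons]
    calc (1 + a) * (s.map fun w => 1 + w).prod
        ≤ ((1 + u) * Real.exp ((a - u) / (1 + u))) *
          ((1 + u) ^ s.card * Real.exp ((s.sum - s.card * u) / (1 + u))) := by
          gcongr
          refine Multiset.prod_nonneg fun w hw => ?_
          obtain ⟨z, hz, rfl⟩ := Multiset.mem_map.1 hw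
          have := hs z (by simp [hz])
          positivity
      _ = (1 + u) ^ (s.card + 1) * (Real.exp ((a - u) / (1 + u)) *
            Real.exp ((s.sum - s.card * u) / (1 + u))) := by ring
      _ = _ := by
          rw [← Real.exp_add, Multiset.card_cons, Multiset.sum_cons]
          congr 2
          push_cast
          ring

open Polynomial in
theorem vdw_univariate (R : ℝ[X]) (k : ℕ) (c : ℝ) (hc : 0 ≤ c) (hsp : R.Splits)
    (hr : ∀ z ∈ R.roots, z ≤ 0) (hdeg : R.natDegree ≤ k + 1)
    (hk : R.eval 0 = 0 ∨ 1 ≤ k) (h0 : 0 ≤ R.eval 0) (hcap : ∀ t : ℝ, 0 < t → c * t ≤ R.eval t) :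
    c * ((k : ℝ) / (k + 1)) ^ k ≤ R.derivative.eval 0 := by
  rcases h0.eq_or_lt with h0 | h0
  · have h1 : c ≤ R.derivative.eval 0 := by
      obtain ⟨Q, hQ⟩ : X ∣ R := X_dvd_iff.2 (by rw [coeff_zero_eq_eval_zero, ← h0])
      have h2 : R.derivative.eval 0 = Q.eval 0 := by rw [hQ]; simp
      rw [h2]
      have hcont : Filter.Tendsto (fun t => Q.eval t) (nhdsWithin 0 (Set.Ioi 0)) (nhds (Q.eval 0)) :=
        (Q.continuous.tendsto 0).mono_left nhdsWithin_le_nhds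
      refine ge_of_tendsto hcont ?_
      filter_upwards [self_mem_nhdsWithin] with t ht
      have ht : 0 < t := ht
      have := hcap t ht
      rw [hQ, eval_mul, eval_X] at this
      nlinarith
    have h3 : ((k : ℝ) / (k + 1)) ^ k ≤ 1 := by
      apply pow_le_one₀ (by positivity)
      rw [div_le_one (by positivity)]; linarith
    nlinarith
  · have hk : 1 ≤ k := hk.resolve_left h0.ne'
    have hk' : (0 : ℝ) < k := by exact_mod_cast hk
    have hr' : ∀ z ∈ R.roots, z < 0 := by
      intro z hz
      refine lt_of_le_of_ne (hr z hz) ?_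
      rintro rfl
      exact h0.ne' (isRoot_of_mem_roots hz)
    set s := (R.roots.map fun z => 1 / (0 - z)).sum with hs
    have hd : R.derivative.eval 0 = R.eval 0 * s := hsp.eval_derivative_eq_eval_mul_sum h0.ne'
    have hs0 : 0 ≤ s := by
      refine Multiset.sum_nonneg fun w hw => ?_
      obtain ⟨z, hz, rfl⟩ := Multiset.mem_map.1 hw
      have := hr z hz
      apply div_nonneg zero_le_one; linarith
    have heval : ∀ t : ℝ, R.eval t =
        R.eval 0 * ((R.roots.map fun z => t * (1 / (0 - z))).map fun w => 1 + w).prod := by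
      intro t
      rw [hsp.eval_eq_prod_roots t, hsp.eval_eq_prod_roots 0, Multiset.map_map, mul_assoc,
        ← Multiset.prod_map_mul]
      congr 2
      refine Multiset.map_congr rfl fun z hz => ?_
      have := hr' z hz
      have h : (0 - z) ≠ 0 := by linarith
      simp only [Function.comp]
      field_simp
      ring
    have hbound : ∀ t u : ℝ, 0 < t → 0 ≤ u → R.eval t ≤ R.eval 0 *
        ((1 + u) ^ R.roots.card * Real.exp ((t * s - R.roots.card * u) / (1 + u))) := by
      intro t u ht hu
      rw [heval t]
      have := vdw_prod_le u hu (R.roots.map fun z => t * (1 / (0 - z))) (by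
        intro w hw
        obtain ⟨z, hz, rfl⟩ := Multiset.mem_map.1 hw
        have := hr z hz
        apply mul_nonneg ht.le
        apply div_nonneg zero_le_one; linarith)
      rw [Multiset.sum_map_mul_left, ← hs, Multiset.card_map] at this
      exact mul_le_mul_of_nonneg_left this h0.le
    rw [hd]
    rcases hs0.eq_or_lt with hs0 | hs0
    · have : c = 0 := by
        by_contra hne
        have hcp : 0 < c := lt_of_le_of_ne hc (Ne.symm hne)
        have h1 := hbound ((R.eval 0 + 1) / c) 0 (by positivity) le_rfl
        have h2 := hcap ((R.eval 0 + 1) / c) (by positivity)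
        rw [mul_div_cancel₀ _ hne] at h2
        rw [← hs0] at h1
        simp at h1
        linarith
      rw [this, ← hs0]; simp
    · set t : ℝ := (k + 1) / (k * s) with ht
      have htp : 0 < t := by positivity
      set u : ℝ := 1 / k with hu
      have hup : 0 < u := by positivity
      have hts : t * s = (k + 1) * u := by rw [ht, hu]; field_simp
      have h1 := (hcap t htp).trans (hbound t u htp hup.le)
      set m := R.roots.card with hm
      have hmk : m ≤ k + 1 := (card_roots' R).trans hdeg
      obtain ⟨e, he⟩ := Nat.exists_eq_add_of_le hmk
      have he' : (k : ℝ) + 1 = m + e := by exact_mod_cast he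
      have h2 : (t * s - m * u) / (1 + u) = e * (u / (1 + u)) := by
        rw [hts, he']; ring
      have h3 : Real.exp (u / (1 + u)) ≤ 1 + u := by
        have := Real.one_sub_inv_le_log_of_pos (show 0 < 1 + u by positivity)
        rw [← Real.le_log_iff_exp_le (by positivity)]
        refine le_trans (le_of_eq ?_) this
        field_simp; ring
      have h4 : (1 + u) ^ m * Real.exp ((t * s - m * u) / (1 + u)) ≤ (1 + u) ^ (k + 1) := by
        rw [h2, he, pow_add, Real.exp_nat_mul]
        gcongr
      have h5 : c * t ≤ R.eval 0 * (1 + u) ^ (k + 1) :=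
        h1.trans (mul_le_mul_of_nonneg_left h4 h0.le)
      have h6 : (1 + u) = (k + 1) / k := by rw [hu]; field_simp
      have h7 : c ≤ R.eval 0 * s * ((k + 1) / k : ℝ) ^ k := by
        have : c = c * t * (k * s / (k + 1)) := by rw [ht]; field_simp
        rw [this]
        calc c * t * (k * s / (k + 1)) ≤ R.eval 0 * (1 + u) ^ (k + 1) * (k * s / (k + 1)) := by
              gcongr
          _ = _ := by rw [h6, pow_succ]; field_simp
      calc c * ((k : ℝ) / (k + 1)) ^ k
          ≤ (R.eval 0 * s * ((k + 1) / k : ℝ) ^ k) * ((k : ℝ) / (k + 1)) ^ k := by gcongr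
        _ = R.eval 0 * s * (((k + 1) / k : ℝ) * ((k : ℝ) / (k + 1))) ^ k := by
            rw [mul_pow]; ring
        _ = R.eval 0 * s := by
            have : ((k + 1) / k : ℝ) * ((k : ℝ) / (k + 1)) = 1 := by field_simp
            rw [this]; simp

/-- Iterated directional derivatives along `a 0, …, a (m-1)`. -/
noncomputable def vdwT {n : ℕ} : ℕ → (ℕ → Fin n → ℝ) → MvPolynomial (Fin n) ℝ →
    MvPolynomial (Fin n) ℝ
  | 0, _, p => p
  | m + 1, a, p => vdwT m (fun j => a (j + 1)) (vdwD (a 0) p)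

theorem vdwT_succ {n : ℕ} (m : ℕ) (a : ℕ → Fin n → ℝ) (p : MvPolynomial (Fin n) ℝ) :
    vdwT (m + 1) a p = vdwD (a m) (vdwT m a p) := by
  induction m generalizing a p with
  | zero => simp [vdwT]
  | succ m ih => rw [vdwT, ih]; rfl

theorem vdwT_zero {n : ℕ} (m : ℕ) (a : ℕ → Fin n → ℝ) : vdwT m a 0 = 0 := by
  induction m with
  | zero => rfl
  | succ m ih => rw [vdwT_succ, ih]; simpa using vdwD_C (a m) 0

theorem vdwT_add {n : ℕ} (m : ℕ) (a : ℕ → Fin n → ℝ) (p q : MvPolynomial (Fin n) ℝ) :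
    vdwT m a (p + q) = vdwT m a p + vdwT m a q := by
  induction m with
  | zero => rfl
  | succ m ih => rw [vdwT_succ, ih, vdwD_add, ← vdwT_succ, ← vdwT_succ]

theorem vdwT_C_mul {n : ℕ} (m : ℕ) (a : ℕ → Fin n → ℝ) (r : ℝ) (p : MvPolynomial (Fin n) ℝ) :
    vdwT m a (MvPolynomial.C r * p) = MvPolynomial.C r * vdwT m a p := by
  induction m with
  | zero => rfl
  | succ m ih => rw [vdwT_succ, ih, vdwD_C_mul, ← vdwT_succ]

theorem vdwT_sum {n : ℕ} {ι : Type} (s : Finset ι) (m : ℕ) (a : ℕ → Fin n → ℝ)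
    (f : ι → MvPolynomial (Fin n) ℝ) :
    vdwT m a (∑ i ∈ s, f i) = ∑ i ∈ s, vdwT m a (f i) := by
  classical
  induction s using Finset.induction_on with
  | empty => simp [vdwT_zero]
  | insert i s hi ih => rw [Finset.sum_insert hi, Finset.sum_insert hi, vdwT_add, ih]

theorem vdwD_prod {n : ℕ} {ι : Type} [DecidableEq ι] (s : Finset ι) (a : Fin n → ℝ)
    (f : ι → MvPolynomial (Fin n) ℝ) :
    vdwD a (∏ i ∈ s, f i) = ∑ i ∈ s, vdwD a (f i) * ∏ j ∈ s.erase i, f j := by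
  induction s using Finset.induction_on with
  | empty => simpa using vdwD_C a 1
  | insert i s hi ih =>
    rw [Finset.prod_insert hi, Finset.sum_insert hi, vdwD_mul, ih, Finset.erase_insert hi,
      Finset.mul_sum, add_comm, mul_comm]
    congr 1
    refine Finset.sum_congr rfl fun j hj => ?_
    have hne : i ≠ j := by rintro rfl; exact hi hj
    rw [Finset.erase_insert_of_ne hne, Finset.prod_insert (by simp [hi])]
    ring

theorem vdwT_perm {n : ℕ} (m : ℕ) (a : ℕ → Fin n → ℝ) (e : Fin m → Fin n) :
    vdwT m a (∏ l, MvPolynomial.X (e l)) =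
      MvPolynomial.C (∑ σ : Equiv.Perm (Fin m), ∏ j : Fin m, a j (e (σ j))) := by
  induction m generalizing a with
  | zero => simp [vdwT]
  | succ m ih =>
    have hD : vdwD (a 0) (∏ l, MvPolynomial.X (e l)) =
        ∑ k : Fin (m + 1), MvPolynomial.C (a 0 (e k)) *
          ∏ l : Fin m, MvPolynomial.X (e (Equiv.swap 0 k l.succ)) := by
      rw [vdwD_prod]
      refine Finset.sum_congr rfl fun k _ => ?_
      rw [vdwD_X]
      congr 1
      symm
      refine Finset.prod_bij (fun l _ => Equiv.swap 0 k l.succ) ?_ ?_ ?_ ?_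
      · intro l _
        simp only [Finset.mem_erase, Finset.mem_univ, and_true]
        intro h
        have := (Equiv.swap 0 k).injective (h.trans (Equiv.swap_apply_left 0 k).symm)
        exact Fin.succ_ne_zero _ this
      · intro l _ l' _ h
        exact Fin.succ_injective _ ((Equiv.swap 0 k).injective h)
      · intro j hj
        simp only [Finset.mem_erase, Finset.mem_univ, and_true] at hj
        have hne : Equiv.swap 0 k j ≠ 0 := by
          intro h
          apply hj
          have h' := congrArg (Equiv.swap 0 k) h
          rwa [Equiv.swap_apply_self, Equiv.swap_apply_left] at h'
        obtain ⟨l, hl⟩ := Fin.exists_succ_eq.2 hne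
        exact ⟨l, Finset.mem_univ _, by rw [hl, Equiv.swap_apply_self]⟩
      · intro l _; rfl
    rw [vdwT, hD, vdwT_sum]
    simp only [vdwT_C_mul, ih, ← map_mul, ← map_sum]
    congr 1
    rw [← Equiv.sum_comp Equiv.Perm.decomposeFin.symm, Fintype.sum_prod_type]
    refine Finset.sum_congr rfl fun k _ => ?_
    rw [Finset.mul_sum]
    refine Finset.sum_congr rfl fun τ _ => ?_
    rw [Fin.prod_univ_succ]
    simp

theorem vdw_good_prod (n : ℕ) : VdwGood n (∏ i : Fin n, (MvPolynomial.X i : MvPolynomial (Fin n) ℝ)) := by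
  refine ⟨?_, ?_, ?_⟩
  · have := MvPolynomial.IsHomogeneous.prod (Finset.univ : Finset (Fin n))
      (fun i => (MvPolynomial.X i : MvPolynomial (Fin n) ℝ)) (fun _ => 1)
      (fun i _ => MvPolynomial.isHomogeneous_X _ _)
    simpa using this
  · intro y hy
    rw [map_prod, Finset.prod_ne_zero_iff]
    intro i _ h
    have := hy i
    simp at h
    simp [h] at this
  · intro v hv
    rw [map_prod]
    exact Finset.prod_pos fun i _ => by simpa using hv i

theorem vdw_good_T {n : ℕ} (a : ℕ → Fin n → ℝ) (ha : ∀ j i, 0 < a j i) (k d : ℕ) (h : k + d = n) :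
    VdwGood d (vdwT k a (∏ i : Fin n, (MvPolynomial.X i : MvPolynomial (Fin n) ℝ))) := by
  induction k generalizing d with
  | zero => obtain rfl : d = n := by omega
            exact vdw_good_prod d
  | succ k ih =>
    rw [vdwT_succ]
    exact (ih (d + 1) (by omega)).deriv _ (ha k)

/-- The capacity constants. -/
noncomputable def vdwC (n d : ℕ) : ℝ :=
  (n.factorial : ℝ) / (n : ℝ) ^ n * ((d : ℝ) ^ d / d.factorial)

theorem vdwC_step (n d : ℕ) : vdwC n d = vdwC n (d + 1) * ((d : ℝ) / (d + 1)) ^ d := by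
  unfold vdwC
  rw [Nat.factorial_succ]
  push_cast
  rw [div_pow, pow_succ]
  field_simp

theorem vdw_cap {n : ℕ} (a : ℕ → Fin n → ℝ) (ha : ∀ j i, 0 < a j i)
    (hrow : ∀ j < n, ∑ i, a j i = 1) (hcol : ∀ i, ∑ j ∈ Finset.Ico 0 n, a j i = 1)
    (k d : ℕ) (h : k + d = n) (x : ℕ → ℝ) (hx : ∀ j, 0 < x j) :
    vdwC n d * ∏ j ∈ Finset.Ico k n, x j ≤
      MvPolynomial.aeval (fun i => ∑ j ∈ Finset.Ico k n, x j * a j i)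
        (vdwT k a (∏ i : Fin n, (MvPolynomial.X i : MvPolynomial (Fin n) ℝ))) := by
  induction k generalizing d x with
  | zero =>
    obtain rfl : d = n := by omega
    have h1 : vdwC d d ≤ 1 := by
      unfold vdwC
      apply le_of_eq
      have : (d : ℝ) ^ d ≠ 0 := by
        rcases Nat.eq_zero_or_pos d with h | h
        · simp [h]
        · positivity
      field_simp
    have hp : 0 ≤ ∏ j ∈ Finset.Ico 0 d, x j := Finset.prod_nonneg fun j _ => (hx j).le
    refine (mul_le_of_le_one_left hp h1).trans ?_
    simp only [vdwT, map_prod, MvPolynomial.aeval_X]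
    calc ∏ j ∈ Finset.Ico 0 d, x j
        = ∏ j ∈ Finset.Ico 0 d, ∏ i : Fin d, x j ^ a j i := by
          refine Finset.prod_congr rfl fun j hj => ?_
          rw [← Real.rpow_sum_of_pos (hx j), hrow j (Finset.mem_Ico.1 hj).2, Real.rpow_one]
      _ = ∏ i : Fin d, ∏ j ∈ Finset.Ico 0 d, x j ^ a j i := Finset.prod_comm
      _ ≤ _ := by
          refine Finset.prod_le_prod (fun i _ => Finset.prod_nonneg fun j _ =>
            Real.rpow_nonneg (hx j).le _) fun i _ => ?_
          refine (Real.geom_mean_le_arith_mean_weighted _ (fun j => a j i) x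
            (fun j _ => (ha j i).le) (hcol i) (fun j _ => (hx j).le)).trans (le_of_eq ?_)
          exact Finset.sum_congr rfl fun j _ => mul_comm _ _
  | succ k ih =>
    have hkn : k < n := by omega
    set g := vdwT k a (∏ i : Fin n, (MvPolynomial.X i : MvPolynomial (Fin n) ℝ)) with hgdef
    have hg : VdwGood (d + 1) g := vdw_good_T a ha k (d + 1) (by omega)
    set y : Fin n → ℝ := fun i => ∑ j ∈ Finset.Ico (k + 1) n, x j * a j i with hy
    have hy0 : ∀ i, 0 ≤ y i := fun i =>
      Finset.sum_nonneg fun j _ => (mul_pos (hx j) (ha j i)).le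
    obtain ⟨hsp, hr⟩ := hg.line y (a k) hy0 (ha k)
    have hd : (vdwLine y (a k) g).derivative.eval 0 = MvPolynomial.aeval y (vdwD (a k) g) := by
      have := vdwLine_derivative y (a k) g
      simp only [Algebra.algebraMap_self, RingHom.id_apply] at this
      rw [this, vdwLine_eval]; simp
    have h0 : (vdwLine y (a k) g).eval 0 = MvPolynomial.aeval y g := by
      rw [vdwLine_eval]; simp
    have hP : 0 < ∏ j ∈ Finset.Ico (k + 1) n, x j := Finset.prod_pos fun j _ => hx j
    have hcap : ∀ t : ℝ, 0 < t → (vdwC n (d + 1) * ∏ j ∈ Finset.Ico (k + 1) n, x j) * t ≤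
        (vdwLine y (a k) g).eval t := by
      intro t ht
      have := ih (d + 1) (by omega) (Function.update x k t) (fun j => by
        by_cases hj : j = k
        · subst hj; simpa using ht
        · simpa [hj] using hx j)
      rw [Finset.prod_eq_prod_Ico_succ_bot hkn] at this
      simp only [Finset.sum_eq_sum_Ico_succ_bot hkn, Function.update_self] at this
      have e1 : ∏ j ∈ Finset.Ico (k + 1) n, Function.update x k t j =
          ∏ j ∈ Finset.Ico (k + 1) n, x j := by
        refine Finset.prod_congr rfl fun j hj => ?_
        have := (Finset.mem_Ico.1 hj).1
        rw [Function.update_of_ne (by omega)]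
      have e2 : ∀ i, ∑ j ∈ Finset.Ico (k + 1) n, Function.update x k t j * a j i = y i := by
        intro i
        refine Finset.sum_congr rfl fun j hj => ?_
        have := (Finset.mem_Ico.1 hj).1
        rw [Function.update_of_ne (by omega)]
      simp only [e1, e2] at this
      rw [vdwLine_eval]
      calc _ = vdwC n (d + 1) * (t * ∏ j ∈ Finset.Ico (k + 1) n, x j) := by ring
        _ ≤ _ := this
        _ = _ := by
          congr 2
          funext i
          ring
    have hcases : (vdwLine y (a k) g).eval 0 = 0 ∨ 1 ≤ d := by
      rcases Nat.eq_zero_or_pos d with hd0 | hd0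
      · left
        rw [h0]
        have hyz : y = fun i => 0 * y i := by
          funext i
          have : Finset.Ico (k + 1) n = ∅ := Finset.Ico_eq_empty (by omega)
          simp [hy, this]
        rw [hyz, vdw_scale _ _ _ hg.homog]; simp
      · right; exact hd0
    have h0' : 0 ≤ (vdwLine y (a k) g).eval 0 := by
      rcases hcases with h | h
      · exact h.ge
      · rw [h0]
        refine (hg.pos y fun i => ?_).le
        refine Finset.sum_pos (fun j _ => mul_pos (hx j) (ha j i)) ?_
        exact ⟨k + 1, Finset.mem_Ico.2 ⟨le_rfl, by omega⟩⟩
    have hc : 0 ≤ vdwC n (d + 1) := by unfold vdwC; positivity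
    have := vdw_univariate _ d _ (mul_nonneg hc hP.le) hsp hr
      (vdwLine_natDegree _ _ _ hg.homog) hcases h0' hcap
    rw [hd] at this
    rw [vdwT_succ, vdwC_step]
    refine le_trans (le_of_eq ?_) this
    ring

theorem vdw_pos (n : ℕ) (A : Matrix (Fin n) (Fin n) ℝ)
    (hpos : ∀ i j, 0 < A i j) (hrow : ∀ i, ∑ j, A i j = 1) (hcol : ∀ j, ∑ i, A i j = 1) :
    (n.factorial : ℝ) / (n : ℝ) ^ n ≤ permanent A := by
  set a : ℕ → Fin n → ℝ := fun j i => if h : j < n then A ⟨j, h⟩ i else 1 with ha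
  have haA : ∀ j : Fin n, a j = A j := by intro j; funext i; simp [ha]
  have h := vdw_cap a (fun j i => by
      by_cases h : j < n
      · simpa [ha, h] using hpos _ _
      · simp [ha, h])
    (fun j hj => by simpa [ha, hj] using hrow ⟨j, hj⟩)
    (fun i => by
      rw [← Finset.range_eq_Ico, Finset.sum_range]
      simp only [haA]; exact hcol i) n 0 (by omega) (fun _ => 1) (fun _ => one_pos)
  rw [vdwT_perm n a (fun i => i)] at h
  simpa [vdwC, haA, permanent] using h

/-- **Van der Waerden conjecture** (Egorychev, Falikman): every doubly stochastic
`n × n` matrix has permanent at least `n!/n^n`. -/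
theorem vanDerWaerden_permanent (n : ℕ) (A : Matrix (Fin n) (Fin n) ℝ)
    (hnonneg : ∀ i j, 0 ≤ A i j)
    (hrow : ∀ i, ∑ j, A i j = 1)
    (hcol : ∀ j, ∑ i, A i j = 1) :
    (n.factorial : ℝ) / (n : ℝ) ^ n ≤ permanent A := by
  rcases Nat.eq_zero_or_pos n with rfl | hn
  · simp [permanent]
  have hn' : (0 : ℝ) < n := by exact_mod_cast hn
  let B : ℝ → Matrix (Fin n) (Fin n) ℝ := fun ε i j => (1 - ε) * A i j + ε / n
  have hcont : Continuous fun ε => permanent (B ε) := by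
    unfold permanent
    simp only [B]
    fun_prop
  have h0 : permanent (B 0) = permanent A := by simp [B, permanent]
  have hlim : Filter.Tendsto (fun ε => permanent (B ε)) (nhdsWithin 0 (Set.Ioi 0))
      (nhds (permanent A)) := by
    rw [← h0]; exact (hcont.tendsto 0).mono_left nhdsWithin_le_nhds
  refine ge_of_tendsto hlim ?_
  filter_upwards [Ioo_mem_nhdsGT (show (0 : ℝ) < 1 by norm_num)] with ε hε
  obtain ⟨h1, h2⟩ := hε
  refine vdw_pos n (B ε) (fun i j => ?_) (fun i => ?_) (fun j => ?_)
  · have := mul_nonneg (sub_nonneg.2 h2.le) (hnonneg i j)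
    have : 0 < ε / n := by positivity
    simp only [B]; linarith
  · simp only [B, Finset.sum_add_distrib, ← Finset.mul_sum, hrow i]
    simp
    field_simp
    ring
  · simp only [B, Finset.sum_add_distrib, ← Finset.mul_sum, hcol j]
    simp
    field_simp
    ring
end

section
/- If A is an n × n matrix with entries in {0,1} such that every row and every column contains exactly r ones (r ≥ 1), then per(A) ≥ r^n · n!/n^n. -/
namespace VdW

/-- Replace the first `k` columns of `B` by `w`. -/
def colMat {n : ℕ} {S : Type*} [CommRing S] (B : Matrix (Fin n) (Fin n) S) (k : ℕ)
    (w : Fin n → S) : Matrix (Fin n) (Fin n) S :=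
  Matrix.of fun i j => if (j : ℕ) < k then w i else B i j

/-- The permanent with the first `k` columns of `B` replaced by `w`. -/
def F {n : ℕ} {S : Type*} [CommRing S] (B : Matrix (Fin n) (Fin n) S) (k : ℕ)
    (w : Fin n → S) : S := (colMat B k w).permanent

lemma F_map {n : ℕ} {S T : Type*} [CommRing S] [CommRing T] (φ : S →+* T)
    (B : Matrix (Fin n) (Fin n) S) (k : ℕ) (w : Fin n → S) :
    φ (F B k w) = F (B.map φ) k (fun i => φ (w i)) := by
  simp only [F, Matrix.permanent, map_sum, map_prod, colMat, Matrix.of_apply, Matrix.map_apply]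
  refine Finset.sum_congr rfl fun σ _ => Finset.prod_congr rfl fun j _ => ?_
  split_ifs <;> rfl

lemma card_lt {n : ℕ} (k : ℕ) (hk : k ≤ n) :
    (Finset.univ.filter fun j : Fin n => (j : ℕ) < k).card = k := by
  rw [Fin.card_filter_val_lt]; omega

lemma F_smul {n : ℕ} {S : Type*} [CommRing S]
    (B : Matrix (Fin n) (Fin n) S) (k : ℕ) (hk : k ≤ n) (c : S) (w : Fin n → S) :
    F B k (fun i => c * w i) = c ^ k * F B k w := by
  simp only [F, Matrix.permanent, colMat, Matrix.of_apply, Finset.mul_sum]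
  refine Finset.sum_congr rfl fun σ _ => ?_
  have h : c ^ k = ∏ j : Fin n, if (j : ℕ) < k then c else 1 := by
    rw [Finset.prod_ite, Finset.prod_const, card_lt k hk]; simp
  rw [h, ← Finset.prod_mul_distrib]
  refine Finset.prod_congr rfl fun j _ => ?_
  split_ifs <;> simp

lemma F_full {n : ℕ} {S : Type*} [CommRing S]
    (B : Matrix (Fin n) (Fin n) S) (w : Fin n → S) :
    F B n w = (n.factorial : S) * ∏ i, w i := by
  simp only [F, Matrix.permanent, colMat, Matrix.of_apply, Fin.is_lt, if_true]
  simp only [fun σ : Equiv.Perm (Fin n) => Equiv.prod_comp σ w]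
  simp [Fintype.card_perm]

lemma F_succ_self {n : ℕ} {S : Type*} [CommRing S]
    (B : Matrix (Fin n) (Fin n) S) (hn : 0 < n) (w : Fin n → S) :
    F B 1 (fun i => B i ⟨0, hn⟩) = F B 0 w := by
  unfold F
  congr 1
  ext i j
  simp only [colMat, Matrix.of_apply]
  by_cases h : (j : ℕ) < 1
  · have : j = ⟨0, hn⟩ := Fin.ext (by simpa using h)
    simp [this]
  · simp [h]

open Polynomial

lemma derivative_permanent {n : ℕ} {S : Type*} [CommRing S]
    (M : Matrix (Fin n) (Fin n) S[X]) :
    derivative M.permanent =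
      ∑ j, (M.updateCol j (fun i => derivative (M i j))).permanent := by
  simp only [Matrix.permanent, derivative_sum, derivative_prod_finset]
  rw [Finset.sum_comm]
  refine Finset.sum_congr rfl fun j _ => Finset.sum_congr rfl fun σ _ => ?_
  rw [← Finset.prod_erase_mul _ _ (Finset.mem_univ j)]
  congr 1
  · refine Finset.prod_congr rfl fun i hi => ?_
    rw [Matrix.updateCol_ne (Finset.ne_of_mem_erase hi)]
  · simp

/-- Restriction to a line. -/
noncomputable def line {n : ℕ} {S : Type*} [CommRing S] (B : Matrix (Fin n) (Fin n) S) (k : ℕ)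
    (w a : Fin n → S) : S[X] := F (B.map C) k (fun i => C (w i) + X * C (a i))

lemma line_eval {n : ℕ} {S : Type*} [CommRing S] (B : Matrix (Fin n) (Fin n) S) (k : ℕ)
    (w a : Fin n → S) (t : S) : (line B k w a).eval t = F B k (fun i => w i + t * a i) := by
  have := F_map (evalRingHom t) (B.map C) k (fun i => C (w i) + X * C (a i))
  simp only [coe_evalRingHom] at this
  rw [line, this]
  congr 1
  · ext i j; simp
  · ext i
    rw [eval_add, eval_mul, eval_X, eval_C, eval_C]

lemma line_natDegree {n : ℕ} {S : Type*} [CommRing S] (B : Matrix (Fin n) (Fin n) S) (k : ℕ)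
    (hk : k ≤ n) (w a : Fin n → S) : (line B k w a).natDegree ≤ k := by
  unfold line F Matrix.permanent
  refine natDegree_sum_le_of_forall_le _ _ fun σ _ => ?_
  refine (natDegree_prod_le _ _).trans ?_
  calc _ ≤ ∑ j : Fin n, (if (j : ℕ) < k then 1 else 0) := by
        refine Finset.sum_le_sum fun j _ => ?_
        simp only [colMat, Matrix.of_apply]
        split_ifs
        · compute_degree
        · simp
    _ = k := by simp [card_lt k hk]

lemma line_derivative {n : ℕ} {S : Type*} [CommRing S] (B : Matrix (Fin n) (Fin n) S) (k : ℕ)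
    (hk : k < n) (w : Fin n → S) :
    derivative (line B (k + 1) w (fun i => B i ⟨k, hk⟩)) =
      (k + 1 : ℕ) * line B k w (fun i => B i ⟨k, hk⟩) := by
  unfold line F
  rw [derivative_permanent]
  set v : Fin n → S[X] := fun i => C (w i) + X * C (B i ⟨k, hk⟩) with hv
  have key : ∀ j : Fin n, ((colMat (B.map C) (k + 1) v).updateCol j
      (fun i => derivative (colMat (B.map C) (k + 1) v i j))).permanent =
      if (j : ℕ) < k + 1 then (colMat (B.map C) k v).permanent else 0 := by
    intro j
    split_ifs with hj
    · rw [← Matrix.permanent_permute_rows (Equiv.swap j ⟨k, hk⟩) (colMat (B.map C) k v)]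
      congr 1
      ext1 i l
      simp only [Matrix.updateCol_apply, Matrix.submatrix_apply, id]
      by_cases hl : l = j
      · subst hl
        simp [colMat, hv, hj, -Order.lt_add_one_iff]
      · rw [if_neg hl]
        by_cases hl2 : l = ⟨k, hk⟩
        · subst hl2
          have : (j : ℕ) < k := by
            have : (j : ℕ) ≠ k := fun h => hl (Fin.ext h.symm)
            omega
          simp [colMat, this]
        · rw [Equiv.swap_apply_of_ne_of_ne hl hl2]
          have : (l : ℕ) ≠ k := fun h => hl2 (Fin.ext h)
          have h3 : (l : ℕ) < k + 1 ↔ (l : ℕ) < k := by omega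
          simp [colMat, h3, -Order.lt_add_one_iff]
    · unfold Matrix.permanent
      refine Finset.sum_eq_zero fun σ _ => Finset.prod_eq_zero (Finset.mem_univ j) ?_
      simp [colMat, hj, -Order.lt_add_one_iff]
  simp only [key]
  rw [← Finset.sum_filter, Finset.sum_const, card_lt (k + 1) hk]
  simp

lemma exists_cone (t : ℂ) (ht : t ∈ Complex.slitPlane) :
    ∃ l : ℂ, 0 < l.re ∧ 0 < (l * t).re := by
  have h0 : 0 < ‖t‖ := norm_pos_iff.2 (Complex.slitPlane_ne_zero ht)
  have h1 : 0 < ‖t‖ + t.re := by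
    rcases Complex.mem_slitPlane_iff.1 ht with h | h
    · linarith
    · have := Complex.abs_re_lt_norm.2 h
      linarith [(abs_lt.1 this).1]
  refine ⟨(‖t‖ : ℂ) + (starRingEnd ℂ) t, by simpa using h1, ?_⟩
  have : ((‖t‖ : ℂ) + (starRingEnd ℂ) t) * t = ((‖t‖ : ℂ)) * (t + ‖t‖) := by
    rw [add_mul, mul_comm ((starRingEnd ℂ) t), Complex.mul_conj, Complex.normSq_eq_norm_sq]
    push_cast; ring
  rw [this, Complex.re_ofReal_mul]
  have : (t + (‖t‖ : ℂ)).re = ‖t‖ + t.re := by simp [add_comm]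
  rw [this]
  positivity

/-- Multisets: AM-GM. -/
lemma amgm (c : ℝ) (hc : 0 < c) (Q : Multiset ℝ) (hQ : ∀ x ∈ Q, 0 ≤ x) :
    (Q.map fun x => 1 + x).prod ≤
      c ^ Q.card * Real.exp ((Q.card + Q.sum) / c - Q.card) := by
  induction Q using Multiset.induction_on with
  | empty => simp
  | cons a Q ih =>
    have ih := ih fun x hx => hQ x (Multiset.mem_cons_of_mem hx)
    have ha : 0 ≤ a := hQ a (Multiset.mem_cons_self a Q)
    have h1 : 1 + a ≤ c * Real.exp ((1 + a) / c - 1) := by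
      have := Real.add_one_le_exp ((1 + a) / c - 1)
      calc 1 + a = c * ((1 + a) / c - 1 + 1) := by field_simp; ring
        _ ≤ _ := by gcongr
    have h2 : 0 ≤ (Q.map fun x => 1 + x).prod := by
      apply Multiset.prod_nonneg
      intro x hx
      obtain ⟨y, hy, rfl⟩ := Multiset.mem_map.1 hx
      linarith [hQ y (Multiset.mem_cons_of_mem hy)]
    rw [Multiset.map_cons, Multiset.prod_cons, Multiset.card_cons, Multiset.sum_cons]
    calc _ ≤ (c * Real.exp ((1 + a) / c - 1)) *
          (c ^ Q.card * Real.exp ((Q.card + Q.sum) / c - Q.card)) := by gcongr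
      _ = c ^ (Q.card + 1) * (Real.exp ((1 + a) / c - 1) *
            Real.exp ((Q.card + Q.sum) / c - Q.card)) := by ring
      _ = _ := by
        rw [← Real.exp_add]
        congr 2
        push_cast
        ring

lemma amgm' (m : ℕ) (hm : 0 < m) (Q : Multiset ℝ) (hQ : ∀ x ∈ Q, 0 ≤ x) (hc : Q.card ≤ m) :
    (Q.map fun x => 1 + x).prod ≤ (1 + Q.sum / m) ^ m := by
  have hs : 0 ≤ Q.sum := Multiset.sum_nonneg hQ
  have hm' : (0 : ℝ) < m := by exact_mod_cast hm
  have := amgm (1 + Q.sum / m) (by positivity) (Q + Multiset.replicate (m - Q.card) 0) (by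
    intro x hx
    rcases Multiset.mem_add.1 hx with h | h
    · exact hQ x h
    · rw [Multiset.eq_of_mem_replicate h])
  simp only [Multiset.map_add, Multiset.prod_add, Multiset.map_replicate, Multiset.card_add,
    Multiset.card_replicate, Multiset.sum_add, Multiset.sum_replicate, Multiset.prod_replicate,
    Nat.add_sub_cancel' hc] at this
  have h2 : ((m : ℝ) + (Q.sum + (m - Q.card) • (0:ℝ))) / (1 + Q.sum / m) - m = 0 := by
    simp only [smul_zero, add_zero]
    have : (1 + Q.sum / m) ≠ 0 := by positivity
    field_simp
    ring
  rw [h2] at this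
  simpa using this

lemma uni (P : ℂ[X]) (m : ℕ) (hm : 0 < m) (hd : P.natDegree ≤ m)
    (hr : ∀ z ∈ P.roots, z.re < 0 ∧ z.im = 0) (r0 y t v : ℝ) (hr0 : 0 < r0) (ht : 0 < t)
    (h0 : P.eval 0 = r0) (h1 : (derivative P).eval 0 = ((m * y : ℝ) : ℂ))
    (hv : P.eval (t : ℂ) = v) : v ≤ r0 * (1 + t * y / r0) ^ m ∧ 0 ≤ y := by
  have hs : P.Splits := IsAlgClosed.splits P
  have hr0' : (r0 : ℂ) ≠ 0 := by exact_mod_cast hr0.ne'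
  have hm' : (0 : ℝ) < m := by exact_mod_cast hm
  have hsum := hs.eval_derivative_div_eval_of_ne_zero (x := 0) (by rw [h0]; exact hr0')
  have A : ∀ Q : Multiset ℂ, (∀ z ∈ Q, z.re < 0 ∧ z.im = 0) →
      (Q.map (fun z => (t : ℂ) - z)).prod = (Q.map (fun z => 0 - z)).prod *
        ((((Q.map fun z => t * (-1 / z.re)).map fun x => 1 + x).prod : ℝ) : ℂ) ∧
      (Q.map fun z => 1 / (0 - z)).sum = (((Q.map fun z => -1 / z.re).sum : ℝ) : ℂ) ∧
      (Q.map fun z => t * (-1 / z.re)).sum = t * (Q.map fun z => -1 / z.re).sum := by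
    intro Q
    induction Q using Multiset.induction_on with
    | empty => simp
    | cons a Q ih =>
      intro h
      obtain ⟨i1, i2, i3⟩ := ih fun z hz => h z (Multiset.mem_cons_of_mem hz)
      obtain ⟨ha, hb⟩ := h a (Multiset.mem_cons_self a Q)
      have e : a = (a.re : ℂ) := Complex.ext (by simp) (by simp [hb])
      have hne : (a.re : ℂ) ≠ 0 := by exact_mod_cast ha.ne
      simp only [Multiset.map_cons, Multiset.prod_cons, Multiset.sum_cons]
      refine ⟨?_, ?_, ?_⟩
      · rw [i1]
        push_cast
        generalize (Multiset.map (fun z : ℂ => 0 - z) Q).prod = p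
        generalize ((((Q.map fun z => t * (-1 / z.re)).map fun x => 1 + x).prod : ℝ) : ℂ) = q
        rw [e]
        simp only [Complex.ofReal_re]
        field_simp
        ring
      · rw [i2]
        push_cast
        congr 1
        conv_lhs => rw [e]
        field_simp
        simp
      · rw [i3]; ring
  obtain ⟨a1, a2, a3⟩ := A P.roots hr
  set Q := P.roots.map fun z => t * (-1 / z.re) with hQ
  set s := (P.roots.map fun z => -1 / z.re).sum with hsdef
  have hs1 : (m * y : ℝ) = s * r0 := by
    have : ((m * y : ℝ) : ℂ) / (r0 : ℂ) = (s : ℂ) := by rw [← a2, ← hsum, h1, h0]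
    rw [div_eq_iff hr0'] at this
    exact_mod_cast this
  have hQ0 : ∀ x ∈ Q, 0 ≤ x := by
    intro x hx
    obtain ⟨z, hz, rfl⟩ := Multiset.mem_map.1 hx
    have := (hr z hz).1
    exact mul_nonneg ht.le (div_nonneg_of_nonpos (by norm_num) this.le)
  have hcard : Q.card ≤ m := by
    rw [hQ, Multiset.card_map]
    exact (P.card_roots').trans hd
  have hvr : v = r0 * (Q.map fun x => 1 + x).prod := by
    have e1 := hs.eval_eq_prod_roots (t : ℂ)
    have e2 := hs.eval_eq_prod_roots 0
    rw [a1, ← mul_assoc, ← e2, h0, hv] at e1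
    exact_mod_cast e1
  have hsQ : 0 ≤ Q.sum := Multiset.sum_nonneg hQ0
  have hs0 : 0 ≤ s := by
    rw [a3] at hsQ
    exact nonneg_of_mul_nonneg_right hsQ ht
  have hy : y = s * r0 / m := by field_simp; linarith
  refine ⟨?_, by rw [hy]; positivity⟩
  rw [hvr]
  have := amgm' m hm Q hQ0 hcard
  have e3 : t * y / r0 = Q.sum / m := by rw [hy, a3]; field_simp
  rw [e3]
  gcongr

lemma F_ofReal {n : ℕ} (A : Matrix (Fin n) (Fin n) ℝ) (k : ℕ) (u : Fin n → ℝ) :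
    ((F A k u : ℝ) : ℂ) = F (A.map Complex.ofRealHom) k (fun i => (u i : ℂ)) :=
  F_map Complex.ofRealHom A k u

lemma F_pos {n : ℕ} (A : Matrix (Fin n) (Fin n) ℝ) (hA : ∀ i j, 0 < A i j) (k : ℕ)
    (u : Fin n → ℝ) (hu : ∀ i, 0 < u i) : 0 < F A k u := by
  unfold F Matrix.permanent
  refine Finset.sum_pos (fun σ _ => Finset.prod_pos fun j _ => ?_) ⟨1, Finset.mem_univ _⟩
  simp only [colMat, Matrix.of_apply]
  split_ifs
  · exact hu _
  · exact hA _ _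

lemma F_continuous {n : ℕ} (B : Matrix (Fin n) (Fin n) ℂ) (k : ℕ) :
    Continuous (F B k) := by
  unfold F Matrix.permanent
  refine continuous_finsetSum _ fun σ _ => continuous_finsetProd _ fun j _ => ?_
  simp only [colMat, Matrix.of_apply]
  split_ifs <;> fun_prop

lemma stab_step {n : ℕ} (A : Matrix (Fin n) (Fin n) ℝ) (hA : ∀ i j, 0 < A i j) (k : ℕ)
    (hk : k < n)
    (ih : ∀ w : Fin n → ℂ, (∀ i, 0 < (w i).re) → F (A.map Complex.ofRealHom) (k + 1) w ≠ 0)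
    (w : Fin n → ℂ) (hw : ∀ i, 0 < (w i).re) : F (A.map Complex.ofRealHom) k w ≠ 0 := by
  set B := A.map Complex.ofRealHom with hB
  set a : Fin n → ℂ := fun i => B i ⟨k, hk⟩ with ha
  have hare : ∀ i, 0 < (a i).re := fun i => by simpa [ha, hB] using hA i ⟨k, hk⟩
  have haim : ∀ i, (a i).im = 0 := fun i => by simp [ha, hB]
  set P := line B (k + 1) w a with hP
  have hder : (derivative P).eval 0 = (k + 1 : ℕ) * F B k w := by
    rw [hP, line_derivative B k hk w, eval_mul, line_eval]
    simp
  have hP0 : P.eval 0 ≠ 0 := by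
    rw [hP, line_eval]
    simpa using ih w hw
  have hPne : P ≠ 0 := fun h => hP0 (by simp [h])
  intro hF
  rw [hF, mul_zero] at hder
  have hs : P.Splits := IsAlgClosed.splits P
  have hsum := hs.eval_derivative_div_eval_of_ne_zero (x := 0) hP0
  rw [hder, zero_div] at hsum
  have hroot : ∀ z ∈ P.roots, z.re < 0 := by
    intro z hz
    by_contra hcon
    have h1 : P.eval z = 0 := (mem_roots hPne).1 hz
    rw [hP, line_eval] at h1
    refine ih _ (fun i => ?_) h1
    have := hw i
    have h2 := hare i
    simp only [Complex.add_re, Complex.mul_re, haim, mul_zero, sub_zero]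
    have : 0 ≤ z.re * (a i).re := mul_nonneg (not_lt.1 hcon) h2.le
    linarith [hw i]
  by_cases hr : P.roots = 0
  · -- `P` is constant
    have hconst : ∀ t : ℂ, F B (k + 1) (fun i => w i + t * a i) = F B (k + 1) w := by
      intro t
      have e1 := hs.eval_eq_prod_roots t
      have e2 := hs.eval_eq_prod_roots 0
      rw [hr] at e1 e2
      have e3 : P.eval t = P.eval 0 := by rw [e1, e2]; simp
      rw [hP, line_eval, line_eval] at e3
      simpa using e3
    have heq : (fun s : ℂ => F B (k + 1) (fun i => s * w i + a i)) =
        fun s => s ^ (k + 1) * F B (k + 1) w := by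
      refine Continuous.ext_on (dense_compl_singleton (0 : ℂ)) ?_ ?_ ?_
      · exact (F_continuous B (k + 1)).comp (by fun_prop)
      · fun_prop
      · intro s hs
        have hs : s ≠ 0 := hs
        simp only
        rw [← hconst s⁻¹, ← F_smul B (k + 1) hk]
        congr 1
        ext i
        field_simp
    have := congrFun heq 0
    simp only [zero_mul, zero_add, ne_eq, Nat.add_eq_zero_iff, one_ne_zero, and_false,
      not_false_eq_true, zero_pow] at this
    exact ih a hare this
  · have hpos : ∀ Q : Multiset ℂ, (∀ z ∈ Q, z.re < 0) → Q ≠ 0 →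
        0 < ((Q.map fun z => 1 / (0 - z)).sum).re := by
      intro Q
      induction Q using Multiset.induction_on with
      | empty => intro _ h; exact absurd rfl h
      | cons b Q ihQ =>
        intro h _
        have hb : 0 < (1 / (0 - b)).re := by
          have hb := h b (Multiset.mem_cons_self b Q)
          rw [zero_sub, one_div, Complex.inv_re]
          refine div_pos (by simpa using hb) (Complex.normSq_pos.2 ?_)
          intro h0
          have : b = 0 := neg_eq_zero.1 h0
          simp [this] at hb
        rw [Multiset.map_cons, Multiset.sum_cons, Complex.add_re]
        by_cases hQ : Q = 0
        · subst hQ; simpa using hb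
        · have := ihQ (fun z hz => h z (Multiset.mem_cons_of_mem hz)) hQ
          linarith
    have := hpos P.roots hroot hr
    rw [← hsum] at this
    simp at this

lemma stab {n : ℕ} (A : Matrix (Fin n) (Fin n) ℝ) (hA : ∀ i j, 0 < A i j) (d : ℕ) :
    ∀ k, k + d = n → ∀ w : Fin n → ℂ, (∀ i, 0 < (w i).re) →
      F (A.map Complex.ofRealHom) k w ≠ 0 := by
  induction d with
  | zero =>
    intro k hk w hw
    have : k = n := by omega
    subst this
    rw [F_full]
    refine mul_ne_zero (by exact_mod_cast Nat.factorial_ne_zero k) ?_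
    refine Finset.prod_ne_zero_iff.2 fun i _ h => ?_
    have := hw i
    simp [h] at this
  | succ d ih =>
    intro k hk w hw
    exact stab_step A hA k (by omega) (ih (k + 1) (by omega)) w hw

lemma roots_real {n : ℕ} (A : Matrix (Fin n) (Fin n) ℝ) (hA : ∀ i j, 0 < A i j) (k : ℕ)
    (hk : k ≤ n) (u a : Fin n → ℝ) (hu : ∀ i, 0 < u i) (ha : ∀ i, 0 < a i) :
    ∀ z ∈ (line (A.map Complex.ofRealHom) k (fun i => (u i : ℂ)) (fun i => (a i : ℂ))).roots,
      z.re < 0 ∧ z.im = 0 := by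
  intro z hz
  have hz0 := (mem_roots'.1 hz).2
  rw [IsRoot, line_eval] at hz0
  have st := stab A hA (n - k) k (by omega)
  have h1 : z ∉ Complex.slitPlane := by
    intro h
    obtain ⟨l, hl1, hl2⟩ := exists_cone z h
    refine st (fun i => l * (u i + z * a i)) (fun i => ?_) ?_
    · have : l * (u i + z * a i) = (u i : ℝ) * l + (a i : ℝ) * (l * z) := by ring
      rw [this, Complex.add_re, Complex.re_ofReal_mul, Complex.re_ofReal_mul]
      have := hu i
      have := ha i
      positivity
    · rw [F_smul _ k hk, hz0, mul_zero]
  have h2 : z ≠ 0 := by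
    rintro rfl
    refine st (fun i => (u i : ℂ)) (fun i => by simpa using hu i) ?_
    simpa using hz0
  rw [Complex.mem_slitPlane_iff, not_or, not_lt, not_not] at h1
  refine ⟨lt_of_le_of_ne h1.1 fun h => h2 (Complex.ext h h1.2), h1.2⟩

lemma key_bound {n : ℕ} (A : Matrix (Fin n) (Fin n) ℝ) (hA : ∀ i j, 0 < A i j) (k : ℕ)
    (hk : k < n) (u : Fin n → ℝ) (hu : ∀ i, 0 < u i) (t : ℝ) (ht : 0 < t) :
    F A (k + 1) (fun i => u i + t * A i ⟨k, hk⟩) ≤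
      F A (k + 1) u * (1 + t * F A k u / F A (k + 1) u) ^ (k + 1) := by
  refine (uni (line (A.map Complex.ofRealHom) (k + 1) (fun i => (u i : ℂ))
    (fun i => (A.map Complex.ofRealHom) i ⟨k, hk⟩)) (k + 1) k.succ_pos
    (line_natDegree _ _ hk _ _) ?_ _ (F A k u) t _ (F_pos A hA (k + 1) u hu) ht ?_ ?_ ?_).1
  · exact roots_real A hA (k + 1) hk u (fun i => A i ⟨k, hk⟩) hu fun i => hA _ _
  · rw [line_eval, F_ofReal]; simp
  · rw [line_derivative, eval_mul, line_eval, Complex.ofReal_mul, F_ofReal]; simp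
  · rw [line_eval, F_ofReal]; simp

lemma filter_succ {n : ℕ} (k : ℕ) (hk : k < n) :
    (Finset.univ.filter fun j : Fin n => (j : ℕ) < k + 1) =
      insert ⟨k, hk⟩ (Finset.univ.filter fun j : Fin n => (j : ℕ) < k) := by
  ext j
  simp only [Finset.mem_filter, Finset.mem_univ, true_and, Finset.mem_insert, Fin.ext_iff]
  omega

lemma cap_zero {n : ℕ} (A : Matrix (Fin n) (Fin n) ℝ) (hA : ∀ i j, 0 < A i j)
    (hrow : ∀ i, ∑ j, A i j = 1) (hcol : ∀ j, ∑ i, A i j = 1)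
    (x : Fin n → ℝ) (hx : ∀ j, 0 < x j) :
    ∏ j, x j ≤ ∏ i, ∑ j, x j * A i j := by
  calc ∏ j, x j = ∏ j, x j ^ (∑ i, A i j) := by simp [hcol]
    _ = ∏ j, ∏ i, x j ^ A i j :=
        Finset.prod_congr rfl fun j _ => Real.rpow_sum_of_pos (hx j) _ _
    _ = ∏ i, ∏ j, x j ^ A i j := Finset.prod_comm
    _ ≤ ∏ i, ∑ j, x j * A i j := by
        refine Finset.prod_le_prod (fun i _ => Finset.prod_nonneg fun j _ =>
          Real.rpow_nonneg (hx j).le _) fun i _ => ?_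
        refine (Real.geom_mean_le_arith_mean_weighted Finset.univ (A i) x
          (fun j _ => (hA i j).le) (hrow i) (fun j _ => (hx j).le)).trans (le_of_eq ?_)
        exact Finset.sum_congr rfl fun j _ => mul_comm _ _

lemma num_step (k : ℕ) (hk : 0 < k) (D R y : ℝ) (hR : 0 < R) (hy : 0 < y)
    (h : ∀ t, 0 < t → D * t ≤ R * (1 + t * y / R) ^ (k + 1)) :
    D * ((k : ℝ) ^ k / ((k + 1 : ℕ) : ℝ) ^ (k + 1)) ≤ y := by
  have hk' : (0 : ℝ) < k := by exact_mod_cast hk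
  have := h (R / (y * k)) (by positivity)
  have e : 1 + R / (y * k) * y / R = ((k + 1 : ℕ) : ℝ) / k := by
    push_cast
    field_simp
  rw [e, div_pow] at this
  have hK : (0 : ℝ) < ((k + 1 : ℕ) : ℝ) := by positivity
  generalize ((k + 1 : ℕ) : ℝ) = K at *
  rw [← mul_div_assoc, div_le_iff₀ (by positivity)]
  rw [← mul_div_assoc, ← mul_div_assoc, div_le_div_iff₀ (by positivity) (by positivity)] at this
  have h3 : (R * k) * (D * (k : ℝ) ^ k) ≤ (R * k) * (y * K ^ (k + 1)) := by
    calc _ = D * R * (k : ℝ) ^ (k + 1) := by ring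
      _ ≤ _ := this
      _ = _ := by ring
  exact le_of_mul_le_mul_left h3 (by positivity)

lemma cap {n : ℕ} (hn : 0 < n) (A : Matrix (Fin n) (Fin n) ℝ) (hA : ∀ i j, 0 < A i j)
    (hrow : ∀ i, ∑ j, A i j = 1) (hcol : ∀ j, ∑ i, A i j = 1) (d : ℕ) :
    ∀ k, k + d = n → ∀ x : Fin n → ℝ, (∀ j, 0 < x j) →
      (n.factorial : ℝ) / (n : ℝ) ^ n * (k : ℝ) ^ k *
          (∏ j ∈ Finset.univ.filter (fun j : Fin n => (j : ℕ) < k), x j) ≤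
        F A k (fun i => ∑ j ∈ Finset.univ.filter (fun j : Fin n => (j : ℕ) < k), x j * A i j) := by
  induction d with
  | zero =>
    intro k hk x hx
    have : k = n := by omega
    subst this
    rw [F_full]
    have hk' : (0 : ℝ) < k := by exact_mod_cast hn
    rw [div_mul_cancel₀ _ (by positivity)]
    simp only [Fin.is_lt, Finset.filter_true]
    refine mul_le_mul_of_nonneg_left ?_ (by positivity)
    exact cap_zero A hA hrow hcol x hx
  | succ d ih =>
    intro k hk x hx
    have hkn : k < n := by omega
    have ih := ih (k + 1) (by omega)
    set S := Finset.univ.filter (fun j : Fin n => (j : ℕ) < k) with hS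
    have hnot : (⟨k, hkn⟩ : Fin n) ∉ S := by simp [hS]
    set u : Fin n → ℝ := fun i => ∑ j ∈ S, x j * A i j with hu
    have hstep : ∀ t, 0 < t → (n.factorial : ℝ) / (n : ℝ) ^ n * ((k + 1 : ℕ) : ℝ) ^ (k + 1) *
        (∏ j ∈ S, x j) * t ≤ F A (k + 1) (fun i => u i + t * A i ⟨k, hkn⟩) := by
      intro t ht
      have := ih (Function.update x ⟨k, hkn⟩ t) (by
        intro j
        by_cases hj : j = ⟨k, hkn⟩
        · subst hj; simpa using ht
        · rw [Function.update_of_ne hj]; exact hx j)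
      have hne : ∀ j ∈ S, Function.update x ⟨k, hkn⟩ t j = x j := fun j hj =>
        Function.update_of_ne (fun h : j = ⟨k, hkn⟩ => hnot (h ▸ hj)) _ _
      rw [filter_succ k hkn, ← hS, Finset.prod_insert hnot, Finset.prod_congr rfl hne] at this
      have e : (fun i => ∑ j ∈ insert ⟨k, hkn⟩ S, Function.update x ⟨k, hkn⟩ t j * A i j) =
          fun i => u i + t * A i ⟨k, hkn⟩ := by
        ext i
        rw [Finset.sum_insert hnot, Finset.sum_congr rfl fun j hj => by rw [hne j hj],
          Function.update_self, add_comm]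
      rw [e, Function.update_self] at this
      refine le_trans (le_of_eq ?_) this
      ring
    rcases Nat.eq_zero_or_pos k with h0 | hkpos
    · subst h0
      have hS0 : S = ∅ := by simp [hS]
      have := hstep 1 one_pos
      simp only [hu, hS0, Finset.sum_empty, Finset.prod_empty, zero_add, one_mul] at this ⊢
      rw [F_succ_self A hn (fun _ => 0)] at this
      simpa using this
    · have hup : ∀ i, 0 < u i := fun i =>
        Finset.sum_pos (fun j _ => mul_pos (hx j) (hA i j)) ⟨⟨0, hn⟩, by simpa [hS] using hkpos⟩
      have := num_step k hkpos _ (F A (k + 1) u) (F A k u) (F_pos A hA _ u hup)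
        (F_pos A hA _ u hup) fun t ht => (hstep t ht).trans (key_bound A hA k hkn u hup t ht)
      refine le_trans (le_of_eq ?_) this
      have hK : (0 : ℝ) < ((k + 1 : ℕ) : ℝ) := by positivity
      field_simp

/-- Van der Waerden bound for strictly positive doubly stochastic matrices. -/
theorem vdw_pos {n : ℕ} (hn : 0 < n) (A : Matrix (Fin n) (Fin n) ℝ) (hA : ∀ i j, 0 < A i j)
    (hrow : ∀ i, ∑ j, A i j = 1) (hcol : ∀ j, ∑ i, A i j = 1) :
    (n.factorial : ℝ) / (n : ℝ) ^ n ≤ A.permanent := by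
  have := cap hn A hA hrow hcol n 0 (by omega) (fun _ => 1) (fun _ => one_pos)
  have e : ∀ w, F A 0 w = A.permanent := by
    intro w
    unfold F
    congr 1
  rw [e] at this
  simpa using this

end VdW

/-- If `A` is an `n × n` 0-1 matrix with exactly `r ≥ 1` ones in every row and
every column, then `per(A) ≥ r^n · n!/n^n`. -/
theorem permanent_regular_lower_bound (n r : ℕ) (hr : 1 ≤ r)
    (A : Matrix (Fin n) (Fin n) ℝ)
    (h01 : ∀ i j, A i j = 0 ∨ A i j = 1)
    (hrow : ∀ i, ∑ j, A i j = (r : ℝ))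
    (hcol : ∀ j, ∑ i, A i j = (r : ℝ)) :
    (r : ℝ) ^ n * (n.factorial : ℝ) / (n : ℝ) ^ n ≤ permanent A := by
  have hper : permanent A = A.permanent := by
    rw [← Matrix.permanent_transpose]; rfl
  rw [hper]
  rcases Nat.eq_zero_or_pos n with h0 | hn
  · subst h0; simp [Matrix.permanent]
  have hr' : (1 : ℝ) ≤ r := by exact_mod_cast hr
  have hn' : (0 : ℝ) < n := by exact_mod_cast hn
  have hA0 : ∀ i j, 0 ≤ A i j := fun i j => by rcases h01 i j with h | h <;> rw [h] <;> norm_num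
  have main : ∀ ε : ℝ, 0 < ε → (r + n * ε) ^ n * (n.factorial : ℝ) / (n : ℝ) ^ n ≤
      (Matrix.of fun i j => A i j + ε).permanent := by
    intro ε hε
    have hc : 0 < r + n * ε := by positivity
    have := VdW.vdw_pos hn ((r + n * ε)⁻¹ • Matrix.of fun i j => A i j + ε)
      (fun i j => by
        have := hA0 i j
        simp only [Matrix.smul_apply, Matrix.of_apply, smul_eq_mul]
        positivity)
      (fun i => by
        simp only [Matrix.smul_apply, Matrix.of_apply, smul_eq_mul]
        rw [← Finset.mul_sum, Finset.sum_add_distrib, hrow]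
        simp [hc.ne'])
      (fun i => by
        simp only [Matrix.smul_apply, Matrix.of_apply, smul_eq_mul]
        rw [← Finset.mul_sum, Finset.sum_add_distrib, hcol]
        simp [hc.ne'])
    rw [Matrix.permanent_smul, Fintype.card_fin, inv_pow, ← div_eq_inv_mul,
      le_div_iff₀ (by positivity)] at this
    refine le_trans (le_of_eq ?_) this
    ring
  have c1 : Continuous fun ε : ℝ => (r + n * ε) ^ n * (n.factorial : ℝ) / (n : ℝ) ^ n := by
    fun_prop
  have c2 : Continuous fun ε : ℝ => (Matrix.of fun i j => A i j + ε).permanent := by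
    unfold Matrix.permanent
    simp only [Matrix.of_apply]
    fun_prop
  have l1 := (c1.tendsto 0).mono_left (nhdsWithin_le_nhds (s := Set.Ioi 0))
  have l2 := (c2.tendsto 0).mono_left (nhdsWithin_le_nhds (s := Set.Ioi 0))
  have := le_of_tendsto_of_tendsto l1 l2
    (Filter.eventually_of_mem self_mem_nhdsWithin fun ε hε => main ε hε)
  simp only [mul_zero, add_zero] at this
  exact this
end
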